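/- In the stationary ergodic environment setting, assume in addition that the pair (a,V) satisfies the scaled hill condition (S) and that, for ℙ-a.e. ω, the set {x ∈ ℝ : a(x,ω) = 0} has zero Lebesgue measure. Let β ≥ 0 and G ∈ 𝒢_sqc. Then for every ε > 0 and y₀ > 0 there exists an event Ω̂(ε,y₀) with ℙ(Ω̂(ε,y₀)) = 1 such that for every ω ∈ Ω̂(ε,y₀) and every u₊ ∈ 𝒮^β_+(ω), u₋ ∈ 𝒮^β_−(ω) the following holds: there exist ℓ₁ < L₁ < L₂ < ℓ₂ such that a(·,ω) > 0 on (ℓ₁,ℓ₂), u₊ and u₋ are C² on (ℓ₁,ℓ₂), ∫_{L₁}^{L₂} dx/a(x,ω) ≥ y₀, and 0 ≤ u₊'(x) − u₋'(x) ≤ ε for all x ∈ [L₁,L₂]. -/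

import Mathlib

open Real Set MeasureTheory

noncomputable section

/-- The class 𝒢(α₀,α₁,γ): growth condition (G1) and local Lipschitz condition (G2). -/
def MemG (α₀ α₁ γ : ℝ) (G : ℝ → ℝ) : Prop :=
  (∀ p : ℝ, α₀ * |p| ^ γ - 1 / α₀ ≤ G p ∧ G p ≤ α₁ * (|p| ^ γ + 1)) ∧
  (∀ p q : ℝ, |G p - G q| ≤ α₁ * (|p| + |q| + 1) ^ (γ - 1) * |p - q|)

/-- The class 𝒢: union of the classes 𝒢(α₀,α₁,γ). -/
def MemGclass (G : ℝ → ℝ) : Prop :=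
  ∃ α₀ α₁ γ : ℝ, 0 < α₀ ∧ 0 < α₁ ∧ 1 < γ ∧ MemG α₀ α₁ γ G

/-- Condition (G4): strict monotonicity with rate η on both half-lines. -/
def StrictIncrRate (G : ℝ → ℝ) (η : ℝ) : Prop :=
  ∀ p₁ p₂ : ℝ, 0 ≤ p₁ → p₁ < p₂ →
    η * (p₂ - p₁) ≤ G p₂ - G p₁ ∧ η * (p₂ - p₁) ≤ G (-p₂) - G (-p₁)

/-- The class 𝒢_sqc: G ∈ 𝒢, G(0) = 0 and (G4) for some η > 0. -/
def MemGsqc (G : ℝ → ℝ) : Prop :=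
  MemGclass G ∧ G 0 = 0 ∧ ∃ η : ℝ, 0 < η ∧ StrictIncrRate G η

/-- G_+^{-1} : the inverse of the restriction of G to [0,∞). -/
def GplusInv (G : ℝ → ℝ) (y : ℝ) : ℝ := Function.invFunOn G (Set.Ici 0) y

/-- G_−^{-1} : the inverse of the restriction of G to (−∞,0]. -/
def GminusInv (G : ℝ → ℝ) (y : ℝ) : ℝ := Function.invFunOn G (Set.Iic 0) y

/-- Viscosity subsolution of a(x)u'' + G(u') + βV(x) = λ on ℝ. -/
def IsViscSubsol (a V G : ℝ → ℝ) (β lam : ℝ) (u : ℝ → ℝ) : Prop :=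
  ∀ x₀ : ℝ, ∀ φ : ℝ → ℝ, ContDiff ℝ 2 φ →
    IsLocalMax (fun x => u x - φ x) x₀ →
    lam ≤ a x₀ * deriv (deriv φ) x₀ + G (deriv φ x₀) + β * V x₀

/-- Viscosity supersolution of a(x)u'' + G(u') + βV(x) = λ on ℝ. -/
def IsViscSupersol (a V G : ℝ → ℝ) (β lam : ℝ) (u : ℝ → ℝ) : Prop :=
  ∀ x₀ : ℝ, ∀ φ : ℝ → ℝ, ContDiff ℝ 2 φ →
    IsLocalMin (fun x => u x - φ x) x₀ →
    a x₀ * deriv (deriv φ) x₀ + G (deriv φ x₀) + β * V x₀ ≤ lam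

/-- Continuous viscosity solution of a(x)u'' + G(u') + βV(x) = λ on ℝ. -/
def IsViscSol (a V G : ℝ → ℝ) (β lam : ℝ) (u : ℝ → ℝ) : Prop :=
  Continuous u ∧ IsViscSubsol a V G β lam u ∧ IsViscSupersol a V G β lam u

/-- The set 𝒮^λ_+ of Lipschitz viscosity solutions with
u'(x) ∈ [G_+^{-1}(λ−β), G_+^{-1}(λ)] for a.e. x ∈ ℝ. -/
def Splus (a V G : ℝ → ℝ) (β lam : ℝ) : Set (ℝ → ℝ) :=
  {u | (∃ K : NNReal, LipschitzWith K u) ∧ IsViscSol a V G β lam u ∧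
    ∀ᵐ x ∂(volume : Measure ℝ),
      deriv u x ∈ Set.Icc (GplusInv G (lam - β)) (GplusInv G lam)}

/-- The set 𝒮^λ_− of Lipschitz viscosity solutions with
u'(x) ∈ [G_−^{-1}(λ), G_−^{-1}(λ−β)] for a.e. x ∈ ℝ. -/
def Sminus (a V G : ℝ → ℝ) (β lam : ℝ) : Set (ℝ → ℝ) :=
  {u | (∃ K : NNReal, LipschitzWith K u) ∧ IsViscSol a V G β lam u ∧
    ∀ᵐ x ∂(volume : Measure ℝ),
      deriv u x ∈ Set.Icc (GminusInv G lam) (GminusInv G (lam - β))}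

/-- If `φ'' ≥ w''` whenever a `C²` function `φ` touches `u` from above, then `u - w` is convex. -/
theorem convexOn_sub_of_touching_above {u w : ℝ → ℝ} {c d : ℝ} (hu : Continuous u)
    (hw : ContDiff ℝ 2 w)
    (h : ∀ x₀ ∈ Ioo c d, ∀ φ : ℝ → ℝ, ContDiff ℝ 2 φ → IsLocalMax (fun x => u x - φ x) x₀ →
      deriv (deriv w) x₀ ≤ deriv (deriv φ) x₀) :
    ConvexOn ℝ (Ioo c d) (fun x => u x - w x) := by
  apply convexOn_of_slope_mono_adjacent (convex_Ioo c d)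
  intro x y z hx hz hxy hyz
  by_contra! hlt
  set f : ℝ → ℝ := fun x => u x - w x with hf
  set m := (f z - f x) / (z - x) with hm
  have hyx : 0 < y - x := by linarith
  have hzy : 0 < z - y := by linarith
  have hzx : 0 < z - x := by linarith
  set D := f y - f x - m * (y - x) with hD
  have hDpos : 0 < D := by
    rw [div_lt_div_iff₀ hzy hyx] at hlt
    have : D * (z - x) = (f y - f x) * (z - y) - (f z - f y) * (y - x) := by
      rw [hD, hm]; field_simp; ring
    have h2 : 0 < D * (z - x) := by rw [this]; simp only [hf]; linarith
    exact pos_of_mul_pos_left h2 hzx.le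
  set e := D / (2 * ((y - x) * (z - y))) with he
  have hepos : 0 < e := by positivity
  have hey : e * ((y - x) * (z - y)) = D / 2 := by rw [he]; field_simp
  set φ : ℝ → ℝ := fun t => w t + (f x + m * (t - x) + e * ((t - x) * (z - t))) with hφ
  have hwd : Differentiable ℝ w := hw.differentiable (by norm_num)
  have hwd' : Differentiable ℝ (deriv w) :=
    ((contDiff_succ_iff_deriv (n := 1)).1 hw).2.2.differentiable (by norm_num)
  have hφc : ContDiff ℝ 2 φ := by
    apply hw.add
    fun_prop
  have hφ1 : deriv φ = fun t => deriv w t + (m + e * (z + x - 2 * t)) := by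
    funext t
    have h1 : HasDerivAt (fun t : ℝ => t) 1 t := hasDerivAt_id' t
    have := (hwd t).hasDerivAt.add ((((h1.sub_const x).const_mul m).const_add (f x)).add
      (((h1.sub_const x).mul (h1.const_sub z)).const_mul e))
    refine (this.congr_deriv ?_).deriv
    ring
  have hφ2 : ∀ t, deriv (deriv φ) t = deriv (deriv w) t - 2 * e := by
    intro t
    rw [hφ1]
    have h1 : HasDerivAt (fun t : ℝ => t) 1 t := hasDerivAt_id' t
    have := (hwd' t).hasDerivAt.add ((((h1.const_mul 2).const_sub (z + x)).const_mul e).const_add m)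
    refine (this.congr_deriv ?_).deriv
    ring
  have hψc : ContinuousOn (fun t => u t - φ t) (Icc x z) :=
    (hu.sub hφc.continuous).continuousOn
  obtain ⟨t, ht, hmax⟩ := isCompact_Icc.exists_isMaxOn (nonempty_Icc.2 (hxy.trans hyz).le) hψc
  have hty : 0 < u t - φ t := by
    have h1 : u y - φ y ≤ u t - φ t := hmax ⟨hxy.le, hyz.le⟩
    have h2 : u y - φ y = D / 2 := by
      simp only [hφ]; rw [hey]; rw [hD]; simp only [hf]; ring
    linarith
  have hxt : x ≠ t := by
    rintro rfl
    simp [hφ, hf] at hty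
  have hzt : t ≠ z := by
    rintro rfl
    have : m * (t - x) = f t - f x := by rw [hm]; field_simp
    simp only [hφ, this] at hty
    simp [hf] at hty
  have hti : t ∈ Ioo x z := ⟨lt_of_le_of_ne ht.1 hxt, lt_of_le_of_ne ht.2 hzt⟩
  have hloc : IsLocalMax (fun t => u t - φ t) t := hmax.isLocalMax (Icc_mem_nhds hti.1 hti.2)
  have := h t ⟨hx.1.trans hti.1, hti.2.trans hz.2⟩ φ hφc hloc
  rw [hφ2] at this
  linarith

/-- If `φ'' ≤ w''` whenever a `C²` function `φ` touches `u` from below, then `w - u` is convex. -/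
theorem convexOn_sub_of_touching_below {u w : ℝ → ℝ} {c d : ℝ} (hu : Continuous u)
    (hw : ContDiff ℝ 2 w)
    (h : ∀ x₀ ∈ Ioo c d, ∀ φ : ℝ → ℝ, ContDiff ℝ 2 φ → IsLocalMin (fun x => u x - φ x) x₀ →
      deriv (deriv φ) x₀ ≤ deriv (deriv w) x₀) :
    ConvexOn ℝ (Ioo c d) (fun x => w x - u x) := by
  have hneg : ∀ g : ℝ → ℝ, deriv (deriv (fun x => -g x)) = fun x => -deriv (deriv g) x := by
    intro g
    have h1 : deriv (fun x => -g x) = fun x => -deriv g x := by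
      funext x; exact deriv.fun_neg
    rw [h1]
    funext x
    exact deriv.fun_neg
  have := convexOn_sub_of_touching_above (u := fun x => -u x) (w := fun x => -w x) (c := c) (d := d)
    hu.neg hw.neg ?_
  · convert this using 2
    ring
  · intro x₀ hx₀ φ hφ hmax
    have hmin : IsLocalMin (fun x => u x - -φ x) x₀ := by
      filter_upwards [hmax] with x hx
      linarith
    have := h x₀ hx₀ (fun x => -φ x) hφ.neg hmin
    rw [hneg] at this ⊢
    linarith

/-- A convex function whose sum with another convex function is differentiable is differentiable. -/
theorem ConvexOn.differentiableAt_of_add {s : Set ℝ} {f g : ℝ → ℝ} (hf : ConvexOn ℝ s f)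
    (hg : ConvexOn ℝ s g) {x : ℝ} (hx : x ∈ interior s)
    (hfg : DifferentiableAt ℝ (fun x => f x + g x) x) : DifferentiableAt ℝ f x := by
  have hr := (hf.hasDerivWithinAt_rightDeriv_of_mem_interior hx)
  have hl := (hf.hasDerivWithinAt_leftDeriv_of_mem_interior hx)
  have h1 := (hr.add (hg.hasDerivWithinAt_rightDeriv_of_mem_interior hx)).derivWithin
    (uniqueDiffWithinAt_Ioi x)
  have h2 := (hl.add (hg.hasDerivWithinAt_leftDeriv_of_mem_interior hx)).derivWithin
    (uniqueDiffWithinAt_Iio x)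
  have h3 := (hfg.hasDerivAt.hasDerivWithinAt (s := Ioi x)).derivWithin (uniqueDiffWithinAt_Ioi x)
  have h4 := (hfg.hasDerivAt.hasDerivWithinAt (s := Iio x)).derivWithin (uniqueDiffWithinAt_Iio x)
  have h5 := hf.leftDeriv_le_rightDeriv_of_mem_interior hx
  have h6 := hg.leftDeriv_le_rightDeriv_of_mem_interior hx
  have h7 := h1.symm.trans (h3.trans (h4.symm.trans h2))
  have h8 : derivWithin f (Ioi x) x = derivWithin f (Iio x) x := by linarith
  rw [h8] at hr
  have := hl.Iic_of_Iio.union hr.Ici_of_Ioi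
  rw [Iic_union_Ici, hasDerivWithinAt_univ] at this
  exact this.differentiableAt

/-- A test function touching a `K`-Lipschitz function from above has slope at most `K`. -/
theorem abs_deriv_le_of_isLocalMax_sub {u φ : ℝ → ℝ} {K : NNReal} (hu : LipschitzWith K u)
    {x₀ : ℝ} (hφ : DifferentiableAt ℝ φ x₀) (h : IsLocalMax (fun x => u x - φ x) x₀) :
    |deriv φ x₀| ≤ K := by
  have hu' : ∀ x, |u x - u x₀| ≤ K * |x - x₀| := fun x => by
    simpa [Real.dist_eq] using hu.dist_le_mul x x₀
  have hev : ∀ᶠ x in nhds x₀, -(K * |x - x₀|) ≤ φ x - φ x₀ := by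
    filter_upwards [h] with x hx
    have := (abs_le.1 (hu' x)).1
    linarith
  have ht := hasDerivAt_iff_tendsto_slope.1 hφ.hasDerivAt
  rw [abs_le]
  constructor
  · refine ge_of_tendsto (ht.mono_left (nhdsWithin_mono x₀ (s := Ioi x₀) fun y hy => ne_of_gt hy)) ?_
    filter_upwards [hev.filter_mono nhdsWithin_le_nhds, self_mem_nhdsWithin] with x hx hx0
    have hx0 : 0 < x - x₀ := sub_pos.2 hx0
    rw [abs_of_pos hx0] at hx
    rw [slope_def_field, le_div_iff₀ hx0]
    linarith
  · refine le_of_tendsto (ht.mono_left (nhdsWithin_mono x₀ (s := Iio x₀) fun y hy => ne_of_lt hy)) ?_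
    filter_upwards [hev.filter_mono nhdsWithin_le_nhds, self_mem_nhdsWithin] with x hx hx0
    have hx0 : x - x₀ < 0 := sub_neg.2 hx0
    rw [abs_of_neg hx0] at hx
    rw [slope_def_field, div_le_iff_of_neg hx0]
    linarith

/-- A test function touching a `K`-Lipschitz function from below has slope at most `K`. -/
theorem abs_deriv_le_of_isLocalMin_sub {u φ : ℝ → ℝ} {K : NNReal} (hu : LipschitzWith K u)
    {x₀ : ℝ} (hφ : DifferentiableAt ℝ φ x₀) (h : IsLocalMin (fun x => u x - φ x) x₀) :
    |deriv φ x₀| ≤ K := by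
  have hmax : IsLocalMax (fun x => (-u) x - (-φ) x) x₀ := by
    filter_upwards [h] with x hx
    simp only [Pi.neg_apply]
    linarith
  have := abs_deriv_le_of_isLocalMax_sub hu.neg hφ.neg hmax
  rwa [deriv.neg, abs_neg] at this

theorem deriv_deriv_const_mul_sq (r x : ℝ) : deriv (deriv fun t : ℝ => r / 2 * t ^ 2) x = r := by
  have h1 : deriv (fun t : ℝ => r / 2 * t ^ 2) = fun t => r * t := by
    funext t
    refine (((hasDerivAt_pow 2 t).const_mul (r / 2)).congr_deriv ?_).deriv
    push_cast
    ring
  rw [h1]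
  simp

/-- A function whose second derivative is bounded by `C` in the viscosity sense is `C^{1,1}`. -/
theorem differentiableAt_of_touching_bound {u : ℝ → ℝ} {c d C : ℝ} (hu : Continuous u)
    (hsub : ∀ x₀ ∈ Ioo c d, ∀ φ : ℝ → ℝ, ContDiff ℝ 2 φ → IsLocalMax (fun x => u x - φ x) x₀ →
      -C ≤ deriv (deriv φ) x₀)
    (hsup : ∀ x₀ ∈ Ioo c d, ∀ φ : ℝ → ℝ, ContDiff ℝ 2 φ → IsLocalMin (fun x => u x - φ x) x₀ →
      deriv (deriv φ) x₀ ≤ C) :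
    (∀ x ∈ Ioo c d, DifferentiableAt ℝ u x) ∧
      ∀ x ∈ Ioo c d, ∀ y ∈ Ioo c d, x ≤ y → |deriv u y - deriv u x| ≤ C * (y - x) := by
  have hq : ∀ r : ℝ, ContDiff ℝ 2 (fun t : ℝ => r / 2 * t ^ 2) := fun r => by fun_prop
  have h1 : ConvexOn ℝ (Ioo c d) (fun x => u x - -C / 2 * x ^ 2) :=
    convexOn_sub_of_touching_above hu (hq (-C)) fun x hx φ hφ hm => by
      rw [deriv_deriv_const_mul_sq]; exact hsub x hx φ hφ hm
  have h2 : ConvexOn ℝ (Ioo c d) (fun x => C / 2 * x ^ 2 - u x) :=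
    convexOn_sub_of_touching_below hu (hq C) fun x hx φ hφ hm => by
      rw [deriv_deriv_const_mul_sq]; exact hsup x hx φ hφ hm
  have hdiff : ∀ x ∈ Ioo c d, DifferentiableAt ℝ u x := by
    intro x hx
    have h3 : DifferentiableAt ℝ (fun x => u x - -C / 2 * x ^ 2) x := by
      refine h1.differentiableAt_of_add h2 (by rwa [interior_Ioo]) ?_
      have : (fun x => (u x - -C / 2 * x ^ 2) + (C / 2 * x ^ 2 - u x)) = fun x => C * x ^ 2 := by
        funext x; ring
      rw [this]
      fun_prop
    have h4 : DifferentiableAt ℝ (fun x : ℝ => -C / 2 * x ^ 2) x := by fun_prop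
    have := h3.add h4
    refine this.congr_of_eventuallyEq (Filter.Eventually.of_forall fun x => ?_)
    simp
  refine ⟨hdiff, fun x hx y hy hxy => ?_⟩
  have hqd : ∀ r t : ℝ, HasDerivAt (fun t : ℝ => r / 2 * t ^ 2) (r * t) t := fun r t => by
    refine ((hasDerivAt_pow 2 t).const_mul (r / 2)).congr_deriv ?_
    push_cast
    ring
  have m1 := h1.monotoneOn_deriv (fun x hx => (hdiff x hx).sub (hqd _ x).differentiableAt) hx hy hxy
  have m2 := h2.monotoneOn_deriv (fun x hx => (hqd _ x).differentiableAt.sub (hdiff x hx)) hx hy hxy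
  rw [((hdiff x hx).hasDerivAt.fun_sub (hqd (-C) x)).deriv,
    ((hdiff y hy).hasDerivAt.fun_sub (hqd (-C) y)).deriv] at m1
  rw [((hqd C x).fun_sub (hdiff x hx).hasDerivAt).deriv,
    ((hqd C y).fun_sub (hdiff y hy).hasDerivAt).deriv] at m2
  rw [abs_le]
  constructor <;> nlinarith

/-- A viscosity solution of `u'' = f(x)` with `f` continuous is a classical solution. -/
theorem hasDerivAt_deriv_of_touching {u f : ℝ → ℝ} {c d : ℝ} (hu : Continuous u)
    (hd : ∀ x ∈ Ioo c d, DifferentiableAt ℝ u x) (hf : ContinuousOn f (Ioo c d))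
    (hsub : ∀ x₀ ∈ Ioo c d, ∀ φ : ℝ → ℝ, ContDiff ℝ 2 φ → IsLocalMax (fun x => u x - φ x) x₀ →
      f x₀ ≤ deriv (deriv φ) x₀)
    (hsup : ∀ x₀ ∈ Ioo c d, ∀ φ : ℝ → ℝ, ContDiff ℝ 2 φ → IsLocalMin (fun x => u x - φ x) x₀ →
      deriv (deriv φ) x₀ ≤ f x₀) {x : ℝ} (hx : x ∈ Ioo c d) :
    HasDerivAt (deriv u) (f x) x := by
  obtain ⟨c', hc, hc'⟩ := exists_between hx.1
  obtain ⟨d', hd', hdd⟩ := exists_between hx.2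
  have hcd : c' ≤ d' := (hc'.trans hd').le
  have hsub' : Icc c' d' ⊆ Ioo c d := fun t ht => ⟨hc.trans_le ht.1, ht.2.trans_lt hdd⟩
  set F : ℝ → ℝ := IccExtend hcd ((Icc c' d').domRestrict f) with hF
  have hFc : Continuous F := (hf.mono hsub').domRestrict.Icc_extend'
  have hFf : ∀ t ∈ Icc c' d', F t = f t := fun t ht => by
    rw [hF, IccExtend_of_mem _ _ ht]; rfl
  set w₁ : ℝ → ℝ := fun t => ∫ s in (0 : ℝ)..t, F s with hw₁
  have hw₁d : ∀ t, HasDerivAt w₁ (F t) t := fun t => hFc.integral_hasStrictDerivAt 0 t |>.hasDerivAt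
  have hw₁c : Continuous w₁ := continuous_iff_continuousAt.2 fun t => (hw₁d t).continuousAt
  set w : ℝ → ℝ := fun t => ∫ s in (0 : ℝ)..t, w₁ s with hw
  have hwd : ∀ t, HasDerivAt w (w₁ t) t := fun t => hw₁c.integral_hasStrictDerivAt 0 t |>.hasDerivAt
  have hw' : deriv w = w₁ := funext fun t => (hwd t).deriv
  have hw₁' : deriv w₁ = F := funext fun t => (hw₁d t).deriv
  have hw₁C : ContDiff ℝ 1 w₁ :=
    contDiff_one_iff_deriv.2 ⟨fun t => (hw₁d t).differentiableAt, hw₁' ▸ hFc⟩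
  have hwC : ContDiff ℝ 2 w :=
    (contDiff_succ_iff_deriv (n := 1)).2
      ⟨fun t => (hwd t).differentiableAt, by simp, hw' ▸ hw₁C⟩
  have hI : Ioo c' d' ⊆ Icc c' d' := Ioo_subset_Icc_self
  have h1 : ConvexOn ℝ (Ioo c' d') (fun x => u x - w x) :=
    convexOn_sub_of_touching_above hu hwC fun t ht φ hφ hm => by
      rw [hw', hw₁', hFf t (hI ht)]; exact hsub t (hsub' (hI ht)) φ hφ hm
  have h2 : ConvexOn ℝ (Ioo c' d') (fun x => w x - u x) :=
    convexOn_sub_of_touching_below hu hwC fun t ht φ hφ hm => by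
      rw [hw', hw₁', hFf t (hI ht)]; exact hsup t (hsub' (hI ht)) φ hφ hm
  have hd1 : ∀ t ∈ Ioo c' d', DifferentiableAt ℝ u t := fun t ht => hd t (hsub' (hI ht))
  have hw2 : ∀ t, DifferentiableAt ℝ w t := fun t => (hwd t).differentiableAt
  have m1 := h1.monotoneOn_deriv (fun t ht => (hd1 t ht).sub (hw2 t))
  have m2 := h2.monotoneOn_deriv (fun t ht => (hw2 t).sub (hd1 t ht))
  have hx' : x ∈ Ioo c' d' := ⟨hc', hd'⟩
  have e1 : ∀ t ∈ Ioo c' d', deriv (fun x => u x - w x) t = deriv u t - w₁ t := fun t ht =>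
    ((hd1 t ht).hasDerivAt.sub (hwd t)).deriv
  have e2 : ∀ t ∈ Ioo c' d', deriv (fun x => w x - u x) t = w₁ t - deriv u t := fun t ht =>
    ((hwd t).sub (hd1 t ht).hasDerivAt).deriv
  have hconst : ∀ t ∈ Ioo c' d', deriv u t = w₁ t + (deriv u x - w₁ x) := by
    intro t ht
    rcases le_total t x with h | h
    · have a1 := m1 ht hx' h
      have a2 := m2 ht hx' h
      rw [e1 t ht, e1 x hx'] at a1
      rw [e2 t ht, e2 x hx'] at a2
      linarith
    · have a1 := m1 hx' ht h
      have a2 := m2 hx' ht h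
      rw [e1 t ht, e1 x hx'] at a1
      rw [e2 t ht, e2 x hx'] at a2
      linarith
  rw [← hFf x (hI hx')]
  refine ((hw₁d x).add_const (deriv u x - w₁ x)).congr_of_eventuallyEq ?_
  filter_upwards [Ioo_mem_nhds hx'.1 hx'.2] with t ht using hconst t ht

/-- Lipschitz viscosity solutions are classical where the diffusion does not degenerate. -/
theorem IsViscSol.classical {a V G u : ℝ → ℝ} {β lam c d : ℝ} {K : NNReal} (ha : Continuous a)
    (hV : Continuous V) (hG : Continuous G) (hpos : ∀ x ∈ Icc c d, 0 < a x)
    (hK : LipschitzWith K u) (hu : IsViscSol a V G β lam u) :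
    ContDiffOn ℝ 2 u (Ioo c d) ∧ ∀ x ∈ Ioo c d,
      HasDerivAt (deriv u) ((lam - β * V x - G (deriv u x)) / a x) x := by
  obtain ⟨huc, husub, husup⟩ := hu
  obtain ⟨C, hC⟩ := (isCompact_Icc (a := c) (b := d)).prod (isCompact_Icc (a := -(K : ℝ)) (b := K))
    |>.exists_bound_of_continuousOn (f := fun p : ℝ × ℝ => (lam - β * V p.1 - G p.2) / a p.1) (by
      refine ContinuousOn.div (by fun_prop) (by fun_prop) ?_
      rintro ⟨x, p⟩ ⟨hx, -⟩
      exact (hpos x hx).ne')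
  have hI : Ioo c d ⊆ Icc c d := Ioo_subset_Icc_self
  have hφd : ∀ φ : ℝ → ℝ, ContDiff ℝ 2 φ → ∀ x, DifferentiableAt ℝ φ x := fun φ hφ =>
    hφ.differentiable (by norm_num)
  have hs1 : ∀ x₀ ∈ Ioo c d, ∀ φ : ℝ → ℝ, ContDiff ℝ 2 φ → IsLocalMax (fun x => u x - φ x) x₀ →
      (lam - β * V x₀ - G (deriv φ x₀)) / a x₀ ≤ deriv (deriv φ) x₀ := by
    intro x hx φ hφ hm
    rw [div_le_iff₀ (hpos x (hI hx))]
    linarith [husub x φ hφ hm]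
  have hs2 : ∀ x₀ ∈ Ioo c d, ∀ φ : ℝ → ℝ, ContDiff ℝ 2 φ → IsLocalMin (fun x => u x - φ x) x₀ →
      deriv (deriv φ) x₀ ≤ (lam - β * V x₀ - G (deriv φ x₀)) / a x₀ := by
    intro x hx φ hφ hm
    rw [le_div_iff₀ (hpos x (hI hx))]
    linarith [husup x φ hφ hm]
  obtain ⟨hdiff, hlip⟩ := differentiableAt_of_touching_bound (C := C) (c := c) (d := d) huc
    (fun x hx φ hφ hm => by
      have h1 := hC (x, deriv φ x) ⟨hI hx,
        abs_le.1 (abs_deriv_le_of_isLocalMax_sub hK (hφd φ hφ x) hm)⟩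
      exact (abs_le.1 h1).1.trans (hs1 x hx φ hφ hm))
    (fun x hx φ hφ hm => by
      have h1 := hC (x, deriv φ x) ⟨hI hx,
        abs_le.1 (abs_deriv_le_of_isLocalMin_sub hK (hφd φ hφ x) hm)⟩
      exact (hs2 x hx φ hφ hm).trans (abs_le.1 h1).2)
  have hcont : ContinuousOn (deriv u) (Ioo c d) := by
    have : LipschitzOnWith (Real.toNNReal C) (deriv u) (Ioo c d) := by
      refine LipschitzOnWith.of_dist_le_mul fun x hx y hy => ?_
      rw [Real.dist_eq, Real.dist_eq]
      rcases le_total x y with h | h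
      · rw [abs_sub_comm, abs_sub_comm x, abs_of_nonneg (sub_nonneg.2 h)]
        exact (hlip x hx y hy h).trans
          (mul_le_mul_of_nonneg_right (Real.le_coe_toNNReal C) (sub_nonneg.2 h))
      · rw [abs_of_nonneg (sub_nonneg.2 h)]
        exact (hlip y hy x hx h).trans
          (mul_le_mul_of_nonneg_right (Real.le_coe_toNNReal C) (sub_nonneg.2 h))
    exact this.continuousOn
  have hfc : ContinuousOn (fun x => (lam - β * V x - G (deriv u x)) / a x) (Ioo c d) := by
    refine ContinuousOn.div ?_ ha.continuousOn fun x hx => (hpos x (hI hx)).ne'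
    exact (continuousOn_const.sub (continuousOn_const.mul hV.continuousOn)).sub
      (hG.comp_continuousOn hcont)
  have hcrit : ∀ x ∈ Ioo c d, ∀ φ : ℝ → ℝ, ContDiff ℝ 2 φ →
      IsLocalExtr (fun x => u x - φ x) x → deriv φ x = deriv u x := by
    intro x hx φ hφ he
    have := he.hasDerivAt_eq_zero ((hdiff x hx).hasDerivAt.sub (hφd φ hφ x).hasDerivAt)
    linarith
  have hder : ∀ x ∈ Ioo c d,
      HasDerivAt (deriv u) ((lam - β * V x - G (deriv u x)) / a x) x := fun x hx =>
    hasDerivAt_deriv_of_touching huc hdiff hfc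
      (fun y hy φ hφ hm => by
        rw [← hcrit y hy φ hφ (Or.inr hm)]; exact hs1 y hy φ hφ hm)
      (fun y hy φ hφ hm => by
        rw [← hcrit y hy φ hφ (Or.inl hm)]; exact hs2 y hy φ hφ hm) hx
  refine ⟨?_, hder⟩
  refine (contDiffOn_succ_iff_deriv_of_isOpen (n := 1) isOpen_Ioo).2
    ⟨fun x hx => (hdiff x hx).differentiableWithinAt, by simp, ?_⟩
  refine (contDiffOn_succ_iff_deriv_of_isOpen (n := 0) isOpen_Ioo).2
    ⟨fun x hx => (hder x hx).differentiableAt.differentiableWithinAt, by simp, ?_⟩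
  rw [contDiffOn_zero]
  exact hfc.congr fun x hx => (hder x hx).deriv

/-- Near a zero of `a`, the integral of `1 / a` exceeds any bound when `√a` is Lipschitz. -/
theorem exists_le_integral_inv_of_zero {a : ℝ → ℝ} {K : NNReal} (h0 : ∀ x, 0 ≤ a x)
    (ha : Continuous a) (hK : LipschitzWith K fun x => √(a x)) (hKpos : 0 < K) {z p y : ℝ}
    (hzp : z < p) (hz : a z = 0) (hpos : ∀ x ∈ Ioc z p, 0 < a x) (hy : 0 < y) :
    ∃ c, z < c ∧ c < p ∧ y ≤ ∫ x in c..p, 1 / a x := by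
  have hK' : (0 : ℝ) < K := hKpos
  have hle : ∀ x ∈ Ioc z p, a x ≤ K ^ 2 * (x - z) ^ 2 := by
    intro x hx
    have h1 := hK.dist_le_mul x z
    simp only [hz, Real.sqrt_zero, Real.dist_eq, sub_zero] at h1
    rw [abs_of_nonneg (Real.sqrt_nonneg _), abs_of_pos (sub_pos.2 hx.1)] at h1
    calc a x = √(a x) ^ 2 := (Real.sq_sqrt (h0 x)).symm
      _ ≤ (K * (x - z)) ^ 2 := pow_le_pow_left₀ (Real.sqrt_nonneg _) h1 2
      _ = _ := by ring
  have hpz : 0 < p - z := sub_pos.2 hzp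
  set s : ℝ := (K ^ 2 * y + (p - z)⁻¹)⁻¹ with hs
  have hsi : s⁻¹ = K ^ 2 * y + (p - z)⁻¹ := by rw [hs, inv_inv]
  have hspos : 0 < s := by positivity
  have hsp : s < p - z := by
    rw [← inv_lt_inv₀ hpz hspos, hsi]
    have : 0 < (K : ℝ) ^ 2 * y := by positivity
    linarith
  have hcp : z + s < p := by linarith
  have hsub : ∀ x ∈ Icc (z + s) p, x ∈ Ioc z p := fun x hx => ⟨by linarith [hx.1], hx.2⟩
  refine ⟨z + s, by linarith, hcp, ?_⟩
  have hc1 : ContinuousOn (fun x => 1 / a x) (uIcc (z + s) p) := by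
    rw [uIcc_of_le hcp.le]
    exact continuousOn_const.div ha.continuousOn fun x hx => (hpos x (hsub x hx)).ne'
  have hc2 : ContinuousOn (fun x => 1 / (K ^ 2 * (x - z) ^ 2)) (uIcc (z + s) p) := by
    rw [uIcc_of_le hcp.le]
    refine continuousOn_const.div (by fun_prop) fun x hx => ?_
    have : 0 < x - z := sub_pos.2 (hsub x hx).1
    positivity
  have hint : ∫ x in (z + s)..p, 1 / ((K : ℝ) ^ 2 * (x - z) ^ 2) = y := by
    rw [intervalIntegral.integral_eq_sub_of_hasDerivAt
      (f := fun x => -((K : ℝ) ^ 2)⁻¹ * (x - z)⁻¹) ?_ hc2.intervalIntegrable]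
    · rw [add_sub_cancel_left, hsi]
      field_simp
      ring
    · intro x hx
      rw [uIcc_of_le hcp.le] at hx
      have hxz : x - z ≠ 0 := (sub_pos.2 (hsub x hx).1).ne'
      refine (((hasDerivAt_id' x).sub_const z).fun_inv hxz
        |>.const_mul (-((K : ℝ) ^ 2)⁻¹)).congr_deriv ?_
      field_simp
  rw [← hint]
  refine intervalIntegral.integral_mono_on hcp.le hc2.intervalIntegrable hc1.intervalIntegrable ?_
  intro x hx
  exact one_div_le_one_div_of_le (hpos x (hsub x hx)) (hle x (hsub x hx))

/-- The last zero of a nonnegative continuous function before a point where it is positive. -/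
theorem exists_last_zero {a : ℝ → ℝ} (h0 : ∀ x, 0 ≤ a x) (ha : Continuous a) {z p : ℝ}
    (hzp : z < p) (hz : a z = 0) (hp : a p ≠ 0) :
    ∃ z', z ≤ z' ∧ z' < p ∧ a z' = 0 ∧ ∀ x ∈ Ioc z' p, 0 < a x := by
  have hcl : IsCompact (Icc z p ∩ a ⁻¹' {0}) :=
    isCompact_Icc.inter_right (isClosed_singleton.preimage ha)
  obtain ⟨z', ⟨hz'1, hz'2⟩, hgr⟩ := hcl.exists_isGreatest ⟨z, ⟨le_rfl, hzp.le⟩, hz⟩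
  refine ⟨z', hz'1.1, lt_of_le_of_ne hz'1.2 ?_, hz'2, fun x hx => ?_⟩
  · rintro rfl
    exact hp hz'2
  · refine lt_of_le_of_ne (h0 x) fun h => ?_
    exact absurd (hgr ⟨⟨hz'1.1.trans hx.1.le, hx.2⟩, h.symm⟩) (not_le.2 hx.1)

/-- A hill on which `1 / max a δ` has integral `y` contains a nondegenerate interval on which
`1 / a` has integral at least `y`. -/
theorem exists_nondegenerate_subinterval {a : ℝ → ℝ} {K : NNReal} (h0 : ∀ x, 0 ≤ a x)
    (ha : Continuous a) (hK : LipschitzWith K fun x => √(a x)) (hKpos : 0 < K)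
    (hnull : volume {x | a x = 0} = 0) {l₁ l₂ δ y : ℝ} (hl : l₁ < l₂) (hδ : 0 < δ) (hy : 0 < y)
    (hint : (∫ x in l₁..l₂, 1 / max (a x) δ) = y) :
    ∃ c d, l₁ ≤ c ∧ c < d ∧ d ≤ l₂ ∧ (∀ x ∈ Icc c d, 0 < a x) ∧ y ≤ ∫ x in c..d, 1 / a x := by
  by_cases hpos : ∀ x ∈ Icc l₁ l₂, 0 < a x
  · refine ⟨l₁, l₂, le_rfl, hl, le_rfl, hpos, ?_⟩
    rw [← hint]
    have hc1 : ContinuousOn (fun x => 1 / a x) (uIcc l₁ l₂) := by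
      rw [uIcc_of_le hl.le]
      exact continuousOn_const.div ha.continuousOn fun x hx => (hpos x hx).ne'
    have hc2 : ContinuousOn (fun x => 1 / max (a x) δ) (uIcc l₁ l₂) :=
      continuousOn_const.div (ha.max continuous_const).continuousOn
        fun x _ => (hδ.trans_le (le_max_right _ _)).ne'
    refine intervalIntegral.integral_mono_on hl.le hc2.intervalIntegrable hc1.intervalIntegrable ?_
    intro x hx
    exact one_div_le_one_div_of_le (hpos x hx) (le_max_left _ _)
  · push Not at hpos
    obtain ⟨z, hz, hz0⟩ := hpos
    have hz0 : a z = 0 := le_antisymm hz0 (h0 z)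
    have hae : ∀ᵐ x ∂(volume : Measure ℝ), a x ≠ 0 := by
      rw [ae_iff]; simpa using hnull
    obtain ⟨p, hp, hpa⟩ := (Measure.dense_of_ae hae).inter_open_nonempty _ isOpen_Ioo
      (nonempty_Ioo.2 hl)
    have hpa : a p ≠ 0 := hpa
    rcases lt_trichotomy z p with h | h | h
    · obtain ⟨z', h1, h2, h3, h4⟩ := exists_last_zero h0 ha h hz0 hpa
      obtain ⟨c, hc1, hc2, hc3⟩ := exists_le_integral_inv_of_zero h0 ha hK hKpos h2 h3 h4 hy
      exact ⟨c, p, by linarith [hz.1], hc2, hp.2.le,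
        fun x hx => h4 x ⟨hc1.trans_le hx.1, hx.2⟩, hc3⟩
    · exact absurd (h ▸ hz0) hpa
    · set b : ℝ → ℝ := fun x => a (-x) with hb
      have hbK : LipschitzWith K fun x => √(b x) := by
        have := hK.comp (LipschitzWith.id.neg)
        rw [mul_one] at this
        exact this
      have hbc : Continuous b := ha.comp continuous_neg
      have hb0 : ∀ x, 0 ≤ b x := fun x => h0 _
      obtain ⟨z', h1, h2, h3, h4⟩ := exists_last_zero (a := b) hb0 hbc (neg_lt_neg h)
        (by simpa [hb] using hz0) (by simpa [hb] using hpa)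
      obtain ⟨c, hc1, hc2, hc3⟩ := exists_le_integral_inv_of_zero hb0 hbc hbK hKpos h2 h3 h4 hy
      refine ⟨p, -c, hp.1.le, by linarith, by linarith [hz.2], fun x hx => ?_, ?_⟩
      · have := h4 (-x) ⟨by linarith [hx.2], by linarith [hx.1]⟩
        simpa [hb] using this
      · have := intervalIntegral.integral_comp_neg (a := c) (b := -p) (fun x => 1 / a x)
        rw [neg_neg] at this
        rw [← this]
        exact hc3

/-- A continuous function that lies in a closed set almost everywhere lies in it everywhere. -/
theorem mem_of_ae_mem_isClosed {f : ℝ → ℝ} {s t : Set ℝ} (hs : IsOpen s) (ht : IsClosed t)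
    (hf : ContinuousOn f s) (h : ∀ᵐ x ∂(volume : Measure ℝ), f x ∈ t) : ∀ x ∈ s, f x ∈ t := by
  intro x hx
  by_contra hxt
  have hopen : IsOpen (s ∩ f ⁻¹' tᶜ) := hf.isOpen_inter_preimage hs ht.isOpen_compl
  obtain ⟨y, hy, hyt⟩ := (Measure.dense_of_ae h).inter_open_nonempty _ hopen ⟨x, hx, hxt⟩
  exact hy.2 hyt

/-- Integrated form of the differential inequality `f' + η (f - k) S' ≤ 0`. -/
theorem mul_exp_antitone_of_deriv_le {f f' S s : ℝ → ℝ} {c d η k : ℝ}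
    (hf : ∀ x ∈ Ioo c d, HasDerivAt f (f' x) x) (hS : ∀ x ∈ Ioo c d, HasDerivAt S (s x) x)
    (h : ∀ x ∈ Ioo c d, f' x + η * (f x - k) * s x ≤ 0) {p q : ℝ} (hp : p ∈ Ioo c d)
    (hq : q ∈ Ioo c d) (hpq : p ≤ q) :
    f q - k ≤ (f p - k) * Real.exp (-(η * (S q - S p))) := by
  have hder : ∀ x ∈ Ioo c d, HasDerivAt (fun x => (f x - k) * Real.exp (η * S x))
      ((f' x + η * (f x - k) * s x) * Real.exp (η * S x)) x := fun x hx => by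
    refine (((hf x hx).sub_const k).mul ((hS x hx).const_mul η).exp).congr_deriv ?_
    ring
  have hanti : AntitoneOn (fun x => (f x - k) * Real.exp (η * S x)) (Ioo c d) := by
    refine antitoneOn_of_deriv_nonpos (convex_Ioo c d)
      (fun x hx => (hder x hx).continuousAt.continuousWithinAt) ?_ ?_
    · rw [interior_Ioo]
      exact fun x hx => (hder x hx).differentiableAt.differentiableWithinAt
    · rw [interior_Ioo]
      intro x hx
      rw [(hder x hx).deriv]
      exact mul_nonpos_of_nonpos_of_nonneg (h x hx) (Real.exp_pos _).le
  have h1 := hanti hp hq hpq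
  have h2 : Real.exp (-(η * (S q - S p))) = Real.exp (η * S p) * Real.exp (-(η * S q)) := by
    rw [← Real.exp_add]; ring_nf
  have h3 : Real.exp (η * S q) * Real.exp (-(η * S q)) = 1 := by
    rw [← Real.exp_add]; simp
  calc f q - k = (f q - k) * Real.exp (η * S q) * Real.exp (-(η * S q)) := by
        rw [mul_assoc, h3, mul_one]
    _ ≤ (f p - k) * Real.exp (η * S p) * Real.exp (-(η * S q)) :=
        mul_le_mul_of_nonneg_right h1 (Real.exp_pos _).le
    _ = _ := by rw [h2, mul_assoc]

theorem MemGclass.continuous {G : ℝ → ℝ} (hG : MemGclass G) : Continuous G := by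
  obtain ⟨α₀, α₁, γ, -, -, hγ, -, hlip⟩ := hG
  refine continuous_iff_continuousAt.2 fun p => ?_
  have hc : Continuous fun q : ℝ => α₁ * (|q| + |p| + 1) ^ (γ - 1) * |q - p| := by
    have : Continuous fun q : ℝ => (|q| + |p| + 1) ^ (γ - 1) :=
      Continuous.rpow_const (by fun_prop) fun q => Or.inr (by linarith)
    fun_prop
  have ht := hc.tendsto p
  rw [sub_self, abs_zero, mul_zero] at ht
  rw [ContinuousAt, tendsto_iff_dist_tendsto_zero]
  exact squeeze_zero (fun q => dist_nonneg) (fun q => by rw [Real.dist_eq]; exact hlip q p) ht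

theorem GplusInv_zero {G : ℝ → ℝ} {η : ℝ} (hη : 0 < η) (h0 : G 0 = 0) (hG : StrictIncrRate G η) :
    GplusInv G 0 = 0 := by
  have hex : ∃ x ∈ Ici (0 : ℝ), G x = 0 := ⟨0, self_mem_Ici, h0⟩
  have h1 : (0 : ℝ) ≤ GplusInv G 0 := Function.invFunOn_mem hex
  have h2 : G (GplusInv G 0) = 0 := Function.invFunOn_eq hex
  rcases h1.eq_or_lt with h | h
  · exact h.symm
  · have := (hG 0 _ le_rfl h).1
    rw [h2, h0] at this
    nlinarith

theorem GminusInv_zero {G : ℝ → ℝ} {η : ℝ} (hη : 0 < η) (h0 : G 0 = 0)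
    (hG : StrictIncrRate G η) : GminusInv G 0 = 0 := by
  have hex : ∃ x ∈ Iic (0 : ℝ), G x = 0 := ⟨0, self_mem_Iic, h0⟩
  have h1 : GminusInv G 0 ≤ 0 := Function.invFunOn_mem hex
  have h2 : G (GminusInv G 0) = 0 := Function.invFunOn_eq hex
  rcases h1.eq_or_lt with h | h
  · exact h
  · have := (hG 0 (-GminusInv G 0) le_rfl (by linarith)).2
    rw [neg_neg, h2, neg_zero, h0] at this
    nlinarith

theorem StrictIncrRate.mul_abs_le {G : ℝ → ℝ} {η : ℝ} (h0 : G 0 = 0) (hG : StrictIncrRate G η)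
    (p : ℝ) : η * |p| ≤ G p := by
  rcases lt_trichotomy p 0 with h | rfl | h
  · have := (hG 0 (-p) le_rfl (by linarith)).2
    rw [neg_neg, neg_zero, h0] at this
    rw [abs_of_neg h]
    linarith
  · simp [h0]
  · have := (hG 0 p le_rfl h).1
    rw [h0] at this
    rw [abs_of_pos h]
    linarith

/-- On a sufficiently long nondegenerate stretch of a high hill the derivatives of the two
correctors are close to each other. -/
theorem correctors_close_on_hill {a V G : ℝ → ℝ} {β η h T y₀ ε c d : ℝ} (ha : Continuous a)
    (hV : Continuous V) (hG : MemGclass G) (h0 : G 0 = 0) (hη : 0 < η) (hGη : StrictIncrRate G η)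
    (hβ : 0 ≤ β) (hh : h ≤ 1) (hT : 0 < T) (hy : 0 < y₀) (hcd : c < d)
    (hpos : ∀ x ∈ Icc c d, 0 < a x) (hhill : ∀ x ∈ Icc c d, h ≤ V x)
    (hlong : y₀ + 2 * T + 2 ≤ ∫ x in c..d, 1 / a x)
    (hε : 2 * (β * (1 - h) / η) +
      (|GplusInv G β| + |GminusInv G β|) * Real.exp (-(η * T)) ≤ ε)
    {up um : ℝ → ℝ} (hup : up ∈ Splus a V G β β) (hum : um ∈ Sminus a V G β β) :
    ∃ ℓ₁ L₁ L₂ ℓ₂ : ℝ, ℓ₁ < L₁ ∧ L₁ < L₂ ∧ L₂ < ℓ₂ ∧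
      (∀ x ∈ Set.Ioo ℓ₁ ℓ₂, 0 < a x) ∧
      ContDiffOn ℝ 2 up (Set.Ioo ℓ₁ ℓ₂) ∧
      ContDiffOn ℝ 2 um (Set.Ioo ℓ₁ ℓ₂) ∧
      y₀ ≤ (∫ x in L₁..L₂, 1 / a x) ∧
      ∀ x ∈ Set.Icc L₁ L₂,
        0 ≤ deriv up x - deriv um x ∧ deriv up x - deriv um x ≤ ε := by
  obtain ⟨⟨K₁, hK₁⟩, hsol₁, hae₁⟩ := hup
  obtain ⟨⟨K₂, hK₂⟩, hsol₂, hae₂⟩ := hum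
  rw [sub_self, GplusInv_zero hη h0 hGη] at hae₁
  rw [sub_self, GminusInv_zero hη h0 hGη] at hae₂
  obtain ⟨hC₁, hd₁⟩ := hsol₁.classical ha hV hG.continuous hpos hK₁
  obtain ⟨hC₂, hd₂⟩ := hsol₂.classical ha hV hG.continuous hpos hK₂
  have hI : Ioo c d ⊆ Icc c d := Ioo_subset_Icc_self
  have hm₁ := mem_of_ae_mem_isClosed isOpen_Ioo isClosed_Icc
    (fun x hx => (hd₁ x hx).continuousAt.continuousWithinAt) hae₁
  have hm₂ := mem_of_ae_mem_isClosed isOpen_Ioo isClosed_Icc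
    (fun x hx => (hd₂ x hx).continuousAt.continuousWithinAt) hae₂
  have hinv : ContinuousOn (fun x => 1 / a x) (Icc c d) :=
    continuousOn_const.div ha.continuousOn fun x hx => (hpos x hx).ne'
  have hii : ∀ p ∈ Icc c d, ∀ q ∈ Icc c d, IntervalIntegrable (fun x => 1 / a x) volume p q :=
    fun p hp q hq => (hinv.mono (uIcc_subset_Icc hp hq)).intervalIntegrable
  have hcm : c ∈ Icc c d := ⟨le_rfl, hcd.le⟩
  set S : ℝ → ℝ := fun x => ∫ t in c..x, 1 / a t with hS
  have hSd : ∀ x ∈ Ioo c d, HasDerivAt S (1 / a x) x := fun x hx => by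
    refine intervalIntegral.integral_hasDerivAt_right (hii c hcm x (hI hx)) ?_
      (hinv.continuousAt (Icc_mem_nhds hx.1 hx.2))
    exact (hinv.mono hI).stronglyMeasurableAtFilter isOpen_Ioo x hx
  have hSc : ContinuousOn S (Icc c d) := by
    have := intervalIntegral.continuousOn_primitive_interval (μ := volume) (a := c) (b := d)
      (f := fun x => 1 / a x) (by
        rw [uIcc_of_le hcd.le]; exact hinv.integrableOn_Icc)
    rwa [uIcc_of_le hcd.le] at this
  have hSmono : MonotoneOn S (Icc c d) := by
    refine monotoneOn_of_deriv_nonneg (convex_Icc c d) hSc ?_ ?_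
    · rw [interior_Icc]
      exact fun x hx => (hSd x hx).differentiableAt.differentiableWithinAt
    · rw [interior_Icc]
      intro x hx
      rw [(hSd x hx).deriv]
      exact (one_div_pos.2 (hpos x (hI hx))).le
  have hSc0 : S c = 0 := by simp [hS]
  have hivt : ∀ v, 0 < v → v < S d → ∃ x ∈ Ioo c d, S x = v := fun v h1 h2 =>
    intermediate_value_Ioo hcd.le hSc ⟨by rwa [hSc0], h2⟩
  have hSd' : y₀ + 2 * T + 2 ≤ S d := hlong
  obtain ⟨p, hp, hpS⟩ := hivt 1 one_pos (by linarith)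
  obtain ⟨L₁, hL₁, hL₁S⟩ := hivt (1 + T) (by linarith) (by linarith)
  obtain ⟨L₂, hL₂, hL₂S⟩ := hivt (1 + T + y₀) (by linarith) (by linarith)
  obtain ⟨q, hq, hqS⟩ := hivt (1 + T + y₀ + T) (by linarith) (by linarith)
  have hlt : ∀ {x y : ℝ}, x ∈ Ioo c d → y ∈ Ioo c d → S x < S y → x < y := fun hx hy hxy =>
    hSmono.reflect_lt (hI hx) (hI hy) hxy
  have hLL : L₁ < L₂ := hlt hL₁ hL₂ (by linarith)
  refine ⟨c, L₁, L₂, d, hL₁.1, hLL, hL₂.2, fun x hx => hpos x (hI hx), hC₁, hC₂, ?_, ?_⟩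
  · have := intervalIntegral.integral_add_adjacent_intervals
      (hii c hcm L₁ (hI hL₁)) (hii L₁ (hI hL₁) L₂ (hI hL₂))
    change S L₁ + _ = S L₂ at this
    linarith
  intro x hx
  have hxI : x ∈ Ioo c d := ⟨hL₁.1.trans_le hx.1, hx.2.trans_lt hL₂.2⟩
  have hSx₁ : S L₁ ≤ S x := hSmono (hI hL₁) (hI hxI) hx.1
  have hSx₂ : S x ≤ S L₂ := hSmono (hI hxI) (hI hL₂) hx.2
  have hpx : p ≤ x := (hlt hp hxI (by linarith)).le
  have hxq : x ≤ q := (hlt hxI hq (by linarith)).le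
  set k := β * (1 - h) / η with hk
  have hk0 : 0 ≤ k := div_nonneg (mul_nonneg hβ (by linarith)) hη.le
  have hkη : η * k = β * (1 - h) := by rw [hk]; field_simp
  have hVle : ∀ t ∈ Ioo c d, β - β * V t ≤ β * (1 - h) := fun t ht => by
    nlinarith [mul_le_mul_of_nonneg_left (hhill t (hI ht)) hβ]
  have hplus := mul_exp_antitone_of_deriv_le (η := η) (k := k) hd₁ hSd (fun t ht => by
    have hG' := hGη.mul_abs_le h0 (deriv up t)
    rw [abs_of_nonneg (hm₁ t ht).1] at hG'
    have hat := hpos t (hI ht)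
    have : (β - β * V t - G (deriv up t)) / a t + η * (deriv up t - k) * (1 / a t) =
      (β - β * V t - G (deriv up t) + η * (deriv up t - k)) / a t := by ring
    rw [this]
    exact div_nonpos_of_nonpos_of_nonneg (by nlinarith [hVle t ht]) hat.le) hp hxI hpx
  have hminus := mul_exp_antitone_of_deriv_le (η := -η) (k := -k) hd₂ hSd (fun t ht => by
    have hG' := hGη.mul_abs_le h0 (deriv um t)
    rw [abs_of_nonpos (hm₂ t ht).2] at hG'
    have hat := hpos t (hI ht)
    have : (β - β * V t - G (deriv um t)) / a t + -η * (deriv um t - -k) * (1 / a t) =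
      (β - β * V t - G (deriv um t) - η * (deriv um t + k)) / a t := by ring
    rw [this]
    exact div_nonpos_of_nonpos_of_nonneg (by nlinarith [hVle t ht]) hat.le) hxI hq hxq
  have hE₁ : Real.exp (-(η * (S x - S p))) ≤ Real.exp (-(η * T)) := by
    apply Real.exp_le_exp.2
    nlinarith
  have hb₁ : deriv up x - k ≤ |GplusInv G β| * Real.exp (-(η * T)) := by
    refine hplus.trans ?_
    have h1 : deriv up p - k ≤ |GplusInv G β| := by
      linarith [(hm₁ p hp).2, le_abs_self (GplusInv G β)]
    exact (mul_le_mul_of_nonneg_right h1 (Real.exp_pos _).le).trans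
      (mul_le_mul_of_nonneg_left hE₁ (abs_nonneg _))
  have hE₂ : Real.exp (-(η * (S q - S x))) ≤ Real.exp (-(η * T)) := by
    apply Real.exp_le_exp.2
    nlinarith
  have hb₂ : -(deriv um x) - k ≤ |GminusInv G β| * Real.exp (-(η * T)) := by
    have h1 : -(deriv um q) - k ≤ |GminusInv G β| := by
      linarith [(hm₂ q hq).1, neg_abs_le (GminusInv G β)]
    have h2 : Real.exp (-(-η * (S q - S x))) * Real.exp (-(η * (S q - S x))) = 1 := by
      rw [← Real.exp_add]; simp
    have h3 := mul_le_mul_of_nonneg_right hminus (Real.exp_pos (-(η * (S q - S x)))).le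
    rw [mul_assoc, h2, mul_one] at h3
    calc -(deriv um x) - k ≤ (-(deriv um q) - k) * Real.exp (-(η * (S q - S x))) := by linarith
      _ ≤ |GminusInv G β| * Real.exp (-(η * (S q - S x))) :=
        mul_le_mul_of_nonneg_right h1 (Real.exp_pos _).le
      _ ≤ _ := mul_le_mul_of_nonneg_left hE₂ (abs_nonneg _)
  exact ⟨by linarith [(hm₁ x hxI).1, (hm₂ x hxI).2], by linarith⟩

theorem scaled_hill_closeness_of_correctors
    {Ω : Type*} [MeasurableSpace Ω] (P : Measure Ω) [IsProbabilityMeasure P]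
    (τ : ℝ → Ω → Ω)
    (hτ_meas : Measurable (fun p : ℝ × Ω => τ p.1 p.2))
    (hτ_zero : ∀ ω, τ 0 ω = ω)
    (hτ_add : ∀ x y : ℝ, ∀ ω, τ (x + y) ω = τ x (τ y ω))
    (hτ_mp : ∀ x : ℝ, MeasurePreserving (τ x) P P)
    (hτ_erg : ∀ g : Ω → ℝ, Measurable g →
      (∀ x : ℝ, ∀ᵐ ω ∂P, g (τ x ω) = g ω) → ∃ c : ℝ, ∀ᵐ ω ∂P, g ω = c)
    (a V : ℝ → Ω → ℝ) (κ : ℝ) (hκ : 0 < κ)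
    (ha_meas : Measurable (fun p : ℝ × Ω => a p.1 p.2))
    (hV_meas : Measurable (fun p : ℝ × Ω => V p.1 p.2))
    (ha_range : ∀ x ω, a x ω ∈ Set.Icc (0 : ℝ) 1)
    (hV_range : ∀ x ω, V x ω ∈ Set.Icc (0 : ℝ) 1)
    (ha_lip : ∀ ω, LipschitzWith (Real.toNNReal κ) (fun x => Real.sqrt (a x ω)))
    (hV_lip : ∀ ω, LipschitzWith (Real.toNNReal κ) (fun x => V x ω))
    (ha_stat : ∀ x ω, a x ω = a 0 (τ x ω))
    (hV_stat : ∀ x ω, V x ω = V 0 (τ x ω))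
    -- the scaled hill condition (S)
    (hS : ∀ h ∈ Set.Ioo (0 : ℝ) 1, ∀ y : ℝ, 0 < y →
      ∃ Ωhy : Set Ω, MeasurableSet Ωhy ∧ P Ωhy = 1 ∧
        ∀ ω ∈ Ωhy, ∃ ℓ₁ ℓ₂ δ : ℝ, ℓ₁ < ℓ₂ ∧ 0 < δ ∧
          (∫ x in ℓ₁..ℓ₂, 1 / max (a x ω) δ) = y ∧
          ∀ x ∈ Set.Icc ℓ₁ ℓ₂, h ≤ V x ω)
    -- the zero set of a(·,ω) is Lebesgue-null for a.e. ω
    (ha_null : ∀ᵐ ω ∂P, volume {x : ℝ | a x ω = 0} = 0)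
    (β : ℝ) (hβ : 0 ≤ β)
    (G : ℝ → ℝ) (hG : MemGsqc G) :
    ∀ ε : ℝ, 0 < ε → ∀ y₀ : ℝ, 0 < y₀ →
      ∃ Ωhat : Set Ω, MeasurableSet Ωhat ∧ P Ωhat = 1 ∧
        ∀ ω ∈ Ωhat,
          ∀ up ∈ Splus (fun x => a x ω) (fun x => V x ω) G β β,
          ∀ um ∈ Sminus (fun x => a x ω) (fun x => V x ω) G β β,
            ∃ ℓ₁ L₁ L₂ ℓ₂ : ℝ, ℓ₁ < L₁ ∧ L₁ < L₂ ∧ L₂ < ℓ₂ ∧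
              (∀ x ∈ Set.Ioo ℓ₁ ℓ₂, 0 < a x ω) ∧
              ContDiffOn ℝ 2 up (Set.Ioo ℓ₁ ℓ₂) ∧
              ContDiffOn ℝ 2 um (Set.Ioo ℓ₁ ℓ₂) ∧
              y₀ ≤ (∫ x in L₁..L₂, 1 / a x ω) ∧
              ∀ x ∈ Set.Icc L₁ L₂,
                0 ≤ deriv up x - deriv um x ∧ deriv up x - deriv um x ≤ ε := by
  intro ε hε y₀ hy₀
  obtain ⟨hGc, hG0, η, hη, hGη⟩ := hG
  set M := |GplusInv G β| + |GminusInv G β| with hM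
  obtain ⟨T, hT0, hT⟩ : ∃ T : ℝ, 0 < T ∧ M * Real.exp (-(η * T)) ≤ ε / 2 := by
    have ht : Filter.Tendsto (fun T : ℝ => M * Real.exp (-(η * T))) Filter.atTop (nhds (M * 0)) :=
      (Real.tendsto_exp_neg_atTop_nhds_zero.comp
        (Filter.tendsto_id.const_mul_atTop hη)).const_mul M
    rw [mul_zero] at ht
    exact ((Filter.eventually_gt_atTop 0).and (ht.eventually_le_const (half_pos hε))).exists
  set s : ℝ := min (1 / 2) (ε * η / (4 * (β + 1))) with hs
  have hs0 : 0 < s := lt_min (by norm_num) (by positivity)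
  have hs1 : s ≤ 1 / 2 := min_le_left _ _
  have hsβ : 2 * (β * s / η) ≤ ε / 2 := by
    have h1 : s * (4 * (β + 1)) ≤ ε * η := (le_div_iff₀ (by positivity)).1 (min_le_right _ _)
    have h2 : β * s / η ≤ ε / 4 := by
      rw [div_le_iff₀ hη]
      nlinarith
    linarith
  obtain ⟨A, hAm, hAP, hA⟩ := hS (1 - s) ⟨by linarith, by linarith⟩ (y₀ + 2 * T + 2) (by linarith)
  obtain ⟨N, hN, hNm, hN0⟩ := exists_measurable_superset_of_null (ae_iff.1 ha_null)
  refine ⟨A ∩ Nᶜ, hAm.inter hNm.compl, ?_, ?_⟩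
  · rwa [measure_inter_conull (by rwa [compl_compl])]
  · rintro ω ⟨hωA, hωN⟩ up hup um hum
    have hnull : volume {x : ℝ | a x ω = 0} = 0 := by
      by_contra h
      exact hωN (hN h)
    have hac : Continuous fun x => a x ω := by
      have := ((ha_lip ω).continuous).pow 2
      refine this.congr fun x => Real.sq_sqrt (ha_range x ω).1
    obtain ⟨l₁, l₂, δ, hl, hδ, hint, hhill⟩ := hA ω hωA
    obtain ⟨c, d, hc, hcd, hd, hpos, hlong⟩ := exists_nondegenerate_subinterval
      (fun x => (ha_range x ω).1) hac (ha_lip ω) (Real.toNNReal_pos.2 hκ) hnull hl hδ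
      (by linarith) hint
    refine correctors_close_on_hill (h := 1 - s) hac (hV_lip ω).continuous hGc hG0 hη hGη hβ
      (by linarith) hT0 hy₀ hcd hpos (fun x hx => hhill x ⟨hc.trans hx.1, hx.2.trans hd⟩) hlong ?_
      hup hum
    rw [sub_sub_cancel]
    linarith
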